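/- There exist c̄₁ > 0 and c̄₂ ≥ 0 such that for all 0 < c₁ ≤ c̄₁ and c₂ ≥ c̄₂ the following hold, where L₁^{c₁,c₂} := {z ∈ N : g⁻(z) ≤ c₁} ∩ cl_{H⁺(y₀)×X}{z ∈ N : g⁺(z) ≥ c₂} and L₂^{c₁,c₂} := L₁^{c₁,c₂} ∩ {z ∈ N : g⁺(z) ≤ c₂}: (1) L₁^{c₁,c₂} ⊂ U; and (2) the pair (r⁻¹(L₁^{c₁,c₂}), r⁻¹(L₂^{c₁,c₂})) is an index pair for (y₀, K). -/

import Mathlib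

open Filter Topology Set
open scoped NNReal ENNReal

noncomputable section

/-- A partial semiflow on a topological space `Z`. The value `none` plays the role of the
symbol `◊` ("undefined").  Time is modelled by `ℝ≥0`. -/
structure PartialSemiflow (Z : Type*) [TopologicalSpace Z] where
  /-- The (partially defined) flow map. -/
  flow : ℝ≥0 → Z → Option Z
  /-- The domain of definition is open in `[0,∞) × Z`. -/
  isOpen_dom : IsOpen {p : ℝ≥0 × Z | (flow p.1 p.2).isSome = true}
  /-- The flow is continuous on its domain of definition. -/
  continuous_flow : ∀ V : Set Z, IsOpen V →
    IsOpen {p : ℝ≥0 × Z | ∃ z ∈ V, flow p.1 p.2 = some z}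
  /-- `z π 0 = z`. -/
  flow_zero : ∀ z, flow 0 z = some z
  /-- The semigroup property; `◊ π t = ◊` is built into `Option.bind`. -/
  flow_add : ∀ (t₁ t₂ : ℝ≥0) (z : Z), flow (t₁ + t₂) z = (flow t₁ z).bind (flow t₂)

namespace PartialSemiflow

variable {Z : Type*} [TopologicalSpace Z] (π : PartialSemiflow Z)

/-- `π.mem t z M` means: `z π t` is defined and belongs to `M`. -/
def mem (t : ℝ≥0) (z : Z) (M : Set Z) : Prop := ∃ w ∈ M, π.flow t z = some w

/-- `π.segMem t z M` means `z π [0,t] ⊆ M`. -/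
def segMem (t : ℝ≥0) (z : Z) (M : Set Z) : Prop := ∀ s ≤ t, π.mem s z M

/-- A full solution `u : ℝ → Z` of the semiflow. -/
def IsSolution (u : ℝ → Z) : Prop :=
  ∀ (t₀ : ℝ) (s : ℝ≥0), π.flow s (u t₀) = some (u (t₀ + (s : ℝ)))

/-- The largest invariant subset of `N`. -/
def Inv (N : Set Z) : Set Z :=
  {z | ∃ u : ℝ → Z, π.IsSolution u ∧ (∀ t, u t ∈ N) ∧ u 0 = z}

/-- The largest negatively invariant subset of `N` (solutions on `(-∞,0]`). -/
def InvMinus (N : Set Z) : Set Z :=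
  {z | ∃ u : ℝ → Z, (∀ t ≤ (0 : ℝ), u t ∈ N) ∧
    (∀ (t₀ : ℝ) (s : ℝ≥0), t₀ + (s : ℝ) ≤ 0 → π.flow s (u t₀) = some (u (t₀ + (s : ℝ)))) ∧
    u 0 = z}

/-- Strong admissibility of a set `M`: asymptotic compactness together with
non-explosion of the semiflow in `M`. -/
def StronglyAdmissible (M : Set Z) : Prop :=
  (∀ (z : ℕ → Z) (t : ℕ → ℝ≥0),
      (∀ n, π.segMem (t n) (z n) M) →
      ∃ w : ℕ → Z, (∀ n, π.flow (t n) (z n) = some (w n)) ∧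
        ∃ φ : ℕ → ℕ, StrictMono φ ∧ ∃ l : Z, Tendsto (w ∘ φ) atTop (nhds l)) ∧
  (∀ (z : Z) (t : ℝ≥0), (∀ s < t, ∃ w ∈ M, π.flow s z = some w) → (π.flow t z).isSome)

end PartialSemiflow

/-- A global (everywhere defined) semiflow on `Y`, the "translation" `y ↦ y^t`. -/
structure GlobalSemiflow (Y : Type*) [TopologicalSpace Y] where
  /-- The translation map. -/
  trans : ℝ≥0 → Y → Y
  continuous_trans : Continuous fun p : ℝ≥0 × Y => trans p.1 p.2
  trans_zero : ∀ y, trans 0 y = y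
  trans_add : ∀ (s t : ℝ≥0) (y : Y), trans (s + t) y = trans t (trans s y)

variable {X Y : Type*} [MetricSpace X] [MetricSpace Y]

/-- `π` is a skew-product semiflow over the translation semiflow `σ`:  whenever
`(y,x) π t` is defined, its first component is `y^t`. -/
def GlobalSemiflow.IsSkewProduct (σ : GlobalSemiflow Y) (π : PartialSemiflow (Y × X)) : Prop :=
  ∀ (t : ℝ≥0) (y : Y) (x : X) (w : Y × X), π.flow t (y, x) = some w → w.1 = σ.trans t y

/-- The positive hull `H⁺(y₀)` of `y₀`. -/
def hullPlus (σ : GlobalSemiflow Y) (y₀ : Y) : Set Y :=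
  closure {y | ∃ t : ℝ≥0, σ.trans t y₀ = y}

/-- The space `H⁺(y₀) × X`, as a subset of `Y × X`. -/
def extSpace (σ : GlobalSemiflow Y) (y₀ : Y) : Set (Y × X) :=
  (hullPlus σ y₀) ×ˢ (Set.univ : Set X)

/-- The map `r = r_{y₀} : [0,∞) × X → H⁺(y₀) × X`, `r(t,x) = (y₀^t, x)`. -/
def rMap (σ : GlobalSemiflow Y) (y₀ : Y) : ℝ≥0 × X → Y × X :=
  fun p => (σ.trans p.1 y₀, p.2)

/-- The canonical semiflow `χ = χ_{y₀}` on `[0,∞) × X`: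
`(t,x) χ s = (t+s, Φ(s, y₀^t, x))`. -/
def chi (σ : GlobalSemiflow Y) (π : PartialSemiflow (Y × X)) (y₀ : Y)
    (s : ℝ≥0) (p : ℝ≥0 × X) : Option (ℝ≥0 × X) :=
  (π.flow s (σ.trans p.1 y₀, p.2)).map fun w => (p.1 + s, w.2)

/-- `chiMem σ π y₀ s p M` means: `p χ s` is defined and belongs to `M`. -/
def chiMem (σ : GlobalSemiflow Y) (π : PartialSemiflow (Y × X)) (y₀ : Y)
    (s : ℝ≥0) (p : ℝ≥0 × X) (M : Set (ℝ≥0 × X)) : Prop :=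
  ∃ q ∈ M, chi σ π y₀ s p = some q

/-- `N` is an isolating neighborhood for `K` in `H⁺(y₀) × X`. -/
def IsIsolatingNbhd (σ : GlobalSemiflow Y) (π : PartialSemiflow (Y × X)) (y₀ : Y)
    (K N : Set (Y × X)) : Prop :=
  N ⊆ extSpace σ y₀ ∧ IsClosed N ∧
  (∀ z ∈ π.Inv N, N ∈ nhdsWithin z (extSpace σ y₀)) ∧ K = π.Inv N

/-- `W` is a neighborhood of `K` in `H⁺(y₀) × X`. -/
def IsNbhdOfIn (σ : GlobalSemiflow Y) (y₀ : Y) (K W : Set (Y × X)) : Prop :=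
  W ⊆ extSpace σ y₀ ∧ ∀ z ∈ K, W ∈ nhdsWithin z (extSpace (X := X) σ y₀)

/-- A basic index pair in `[0,∞) × X` relative to the semiflow `χ_{y₀}`. -/
structure IsBasicIndexPair (σ : GlobalSemiflow Y) (π : PartialSemiflow (Y × X)) (y₀ : Y)
    (N₁ N₂ : Set (ℝ≥0 × X)) : Prop where
  subset : N₂ ⊆ N₁
  closed₁ : IsClosed N₁
  closed₂ : IsClosed N₂
  ip2 : ∀ p ∈ N₁, ∀ t : ℝ≥0, ¬ chiMem σ π y₀ t p N₁ → ∃ s ≤ t, chiMem σ π y₀ s p N₂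
  ip3 : ∀ p ∈ N₂, ∀ t : ℝ≥0, ¬ chiMem σ π y₀ t p N₂ → ∃ s ≤ t, ¬ chiMem σ π y₀ s p N₁

/-- An index pair for `(y₀, K)`. -/
structure IsIndexPair (σ : GlobalSemiflow Y) (π : PartialSemiflow (Y × X)) (y₀ : Y)
    (K : Set (Y × X)) (N₁ N₂ : Set (ℝ≥0 × X)) : Prop where
  toBasic : IsBasicIndexPair σ π y₀ N₁ N₂
  ip4 : ∃ N : Set (Y × X), IsIsolatingNbhd σ π y₀ K N ∧ π.StronglyAdmissible N ∧
    N₁ \ N₂ ⊆ rMap σ y₀ ⁻¹' N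
  ip5 : ∃ W : Set (Y × X), IsNbhdOfIn σ y₀ K W ∧ rMap σ y₀ ⁻¹' W ⊆ N₁ \ N₂

/-- `N₂^{-T}(N₁) = {p ∈ N₁ : p χ s ∈ N₂ for some s ∈ [0,T]}`. -/
def backSet (σ : GlobalSemiflow Y) (π : PartialSemiflow (Y × X)) (y₀ : Y)
    (N₁ N₂ : Set (ℝ≥0 × X)) (T : ℝ≥0) : Set (ℝ≥0 × X) :=
  {p ∈ N₁ | ∃ s ≤ T, chiMem σ π y₀ s p N₂}


/-- The relation identifying all points of `A ∩ B`, together with an extra point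
(which serves as the class `[B]` even when `A ∩ B = ∅`). -/
def quotRel {Z : Type*} (A B : Set Z) : ↥A ⊕ Unit → ↥A ⊕ Unit → Prop
  | Sum.inl a, Sum.inl b => a = b ∨ ((a : Z) ∈ B ∧ (b : Z) ∈ B)
  | Sum.inl a, Sum.inr _ => (a : Z) ∈ B
  | Sum.inr _, Sum.inl b => (b : Z) ∈ B
  | Sum.inr _, Sum.inr _ => True

/-- The pointed quotient space `A/B`. -/
def PtdQuot {Z : Type*} [TopologicalSpace Z] (A B : Set Z) : Type _ := Quot (quotRel A B)

instance {Z : Type*} [TopologicalSpace Z] (A B : Set Z) : TopologicalSpace (PtdQuot A B) :=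
  inferInstanceAs (TopologicalSpace (Quot _))

/-- The base point `[B]` of `A/B`. -/
def PtdQuot.pt {Z : Type*} [TopologicalSpace Z] (A B : Set Z) : PtdQuot A B :=
  Quot.mk _ (Sum.inr ())

/-- `f : (Z, z₀) → (W, w₀)` is a pointed homotopy equivalence. -/
def IsPointedHomotopyEquiv {Z W : Type*} [TopologicalSpace Z] [TopologicalSpace W]
    (z₀ : Z) (w₀ : W) (f : C(Z, W)) : Prop :=
  f z₀ = w₀ ∧ ∃ g : C(W, Z), g w₀ = z₀ ∧
    Nonempty (ContinuousMap.HomotopyRel (g.comp f) (ContinuousMap.id Z) {z₀}) ∧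
    Nonempty (ContinuousMap.HomotopyRel (f.comp g) (ContinuousMap.id W) {w₀})

/-- There is a pointed homotopy equivalence `(Z,z₀) → (W,w₀)`. -/
def PointedHomotopyEquivalent {Z W : Type*} [TopologicalSpace Z] [TopologicalSpace W]
    (z₀ : Z) (w₀ : W) : Prop :=
  ∃ f : C(Z, W), IsPointedHomotopyEquiv z₀ w₀ f

variable {X Y : Type*} [MetricSpace X] [MetricSpace Y]

/-- `g⁺(z) = sup{t ≥ 0 : z π [0,t] ⊆ U}`, with `sup ∅ = 0`, valued in `[0,∞]`. -/
def gPlus (π : PartialSemiflow (Y × X)) (U : Set (Y × X)) (z : Y × X) : ℝ≥0∞ :=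
  ⨆ t ∈ {t : ℝ≥0 | π.segMem t z U}, (t : ℝ≥0∞)

/-- `g⁻(z) = sup{d(z π t, Inv⁻(N)) : t ∈ [0, g⁺(z)], z π t ≠ ◊}`, with `sup ∅ = 0`
and `d(·,∅) = ∞`, valued in `[0,∞]`. -/
def gMinus (π : PartialSemiflow (Y × X)) (U N : Set (Y × X)) (z : Y × X) : ℝ≥0∞ :=
  ⨆ t ∈ {t : ℝ≥0 | (t : ℝ≥0∞) ≤ gPlus π U z},
    ⨆ w ∈ {w : Y × X | π.flow t z = some w}, EMetric.infEdist w (π.InvMinus N)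

/-- The function `f(p) = sup{t₀ ≥ 0 : p χ s ∈ cl(N₁ \ N₂) for all s ∈ [0,t₀]}`,
with `sup ∅ = 0`, valued in `[0,∞]`. -/
def fTime (σ : GlobalSemiflow Y) (π : PartialSemiflow (Y × X)) (y₀ : Y)
    (N₁ N₂ : Set (ℝ≥0 × X)) (p : ℝ≥0 × X) : ℝ≥0∞ :=
  ⨆ t₀ ∈ {t₀ : ℝ≥0 | ∀ s ≤ t₀, chiMem σ π y₀ s p (closure (N₁ \ N₂))}, (t₀ : ℝ≥0∞)

/-- The α-limit set of a full solution `u`. -/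
def solAlphaLimit (u : ℝ → Y × X) : Set (Y × X) := ⋂ t : ℝ, closure (u '' Set.Iic t)

/-- The ω-limit set of a full solution `u`. -/
def solOmegaLimit (u : ℝ → Y × X) : Set (Y × X) := ⋂ t : ℝ, closure (u '' Set.Ici t)

/-- `(A, R)` is an attractor-repeller decomposition of the isolated invariant set `K`. -/
structure IsARDecomp (σ : GlobalSemiflow Y) (π : PartialSemiflow (Y × X)) (y₀ : Y)
    (K A R : Set (Y × X)) : Prop where
  A_subset : A ⊆ K
  R_subset : R ⊆ K
  disjoint : Disjoint A R
  A_isolated : ∃ N, IsIsolatingNbhd σ π y₀ A N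
  R_isolated : ∃ N, IsIsolatingNbhd σ π y₀ R N
  alternatives : ∀ u : ℝ → Y × X, π.IsSolution u → (∀ t, u t ∈ K) →
    (∀ t, u t ∈ A) ∨ (∀ t, u t ∈ R) ∨ (solAlphaLimit u ⊆ R ∧ solOmegaLimit u ⊆ A)

/-- An index triple for `(y₀, K, A, R)`. -/
structure IsIndexTriple (σ : GlobalSemiflow Y) (π : PartialSemiflow (Y × X)) (y₀ : Y)
    (K A R : Set (Y × X)) (N₁ N₂ N₃ : Set (ℝ≥0 × X)) : Prop where
  sub32 : N₃ ⊆ N₂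
  sub21 : N₂ ⊆ N₁
  pairK : IsIndexPair σ π y₀ K N₁ N₃
  pairA : IsIndexPair σ π y₀ A N₂ N₃

/-- An FM-index pair for `K` relative to `π`, restricted to `H⁺(y₀) × X`. -/
structure IsFMIndexPair (σ : GlobalSemiflow Y) (π : PartialSemiflow (Y × X)) (y₀ : Y)
    (K N₁ N₂ : Set (Y × X)) : Prop where
  subset : N₂ ⊆ N₁
  sub_ext : N₁ ⊆ extSpace σ y₀
  closed₁ : IsClosed N₁
  closed₂ : IsClosed N₂
  isolating : IsIsolatingNbhd σ π y₀ K (closure (N₁ \ N₂))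
  interior_K : ∀ z ∈ K, N₁ \ N₂ ∈ nhdsWithin z (extSpace σ y₀)
  posInv : ∀ z ∈ N₂, ∀ t : ℝ≥0, (∀ s ≤ t, π.mem s z N₁) → ∀ s ≤ t, π.mem s z N₂
  exit : ∀ z ∈ N₁, ∀ t : ℝ≥0, ¬ π.mem t z N₁ →
    ∃ s ≤ t, (∀ s' ≤ s, π.mem s' z N₁) ∧ π.mem s z N₂


namespace PartialSemiflow

section Topological

variable {Z : Type*} [TopologicalSpace Z] {π : PartialSemiflow Z}

theorem segMem.mono {s t : ℝ≥0} {z : Z} {M : Set Z} (h : π.segMem t z M) (hst : s ≤ t) :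
    π.segMem s z M :=
  fun r hr => h r (hr.trans hst)

theorem flow_add_of_eq_some {s t : ℝ≥0} {z w : Z} (h : π.flow t z = some w) :
    π.flow (t + s) z = π.flow s w := by
  rw [π.flow_add, h, Option.bind_some]

theorem eventually_mem {t : ℝ≥0} {z : Z} {V : Set Z} (hV : IsOpen V) (h : π.mem t z V) :
    ∀ᶠ p : ℝ≥0 × Z in 𝓝 (t, z), π.mem p.1 p.2 V :=
  (π.continuous_flow V hV).mem_nhds h

theorem tendsto_flow {ι : Type*} {l : Filter ι} {τ : ι → ℝ≥0} {ζ ξ : ι → Z} {t : ℝ≥0} {z w : Z}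
    (hτ : Tendsto τ l (𝓝 t)) (hζ : Tendsto ζ l (𝓝 z)) (hw : π.flow t z = some w)
    (hξ : ∀ᶠ i in l, π.flow (τ i) (ζ i) = some (ξ i)) : Tendsto ξ l (𝓝 w) := by
  refine tendsto_nhds.2 fun V hV hwV => ?_
  filter_upwards [(hτ.prodMk_nhds hζ).eventually (eventually_mem hV ⟨w, hwV, hw⟩), hξ]
  rintro i ⟨v, hv, hv'⟩ hi
  obtain rfl : v = ξ i := Option.some.inj (hv'.symm.trans hi)
  exact hv

theorem mem_of_tendsto {ι : Type*} {l : Filter ι} [l.NeBot] {τ : ι → ℝ≥0} {ζ : ι → Z} {t : ℝ≥0}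
    {z w : Z} {M : Set Z} (hM : IsClosed M)
    (hτ : Tendsto τ l (𝓝 t)) (hζ : Tendsto ζ l (𝓝 z)) (hw : π.flow t z = some w)
    (h : ∀ᶠ i in l, π.mem (τ i) (ζ i) M) : w ∈ M := by
  by_contra hwM
  obtain ⟨i, ⟨v, hv, hv'⟩, ⟨v₂, hv₂, hv₂'⟩⟩ :=
    (h.and ((hτ.prodMk_nhds hζ).eventually (eventually_mem hM.isOpen_compl ⟨w, hwM, hw⟩))).exists
  exact hv₂ (Option.some.inj (hv'.symm.trans hv₂') ▸ hv)

/-- In a closed set in which the semiflow does not explode, limits of orbit segments are orbit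
segments. -/
theorem segMem_of_tendsto {ι : Type*} {l : Filter ι} [l.NeBot] {ζ : ι → Z} {t : ℝ≥0} {z : Z}
    {M : Set Z} (hM : IsClosed M) (hadm : π.StronglyAdmissible M)
    (hζ : Tendsto ζ l (𝓝 z)) (h : ∀ᶠ i in l, π.segMem t (ζ i) M) : π.segMem t z M := by
  have key : ∀ s ≤ t, ∀ w, π.flow s z = some w → w ∈ M := fun s hs w hw =>
    mem_of_tendsto hM tendsto_const_nhds hζ hw (h.mono fun i hi => hi s hs)
  suffices hdef : ∀ s ≤ t, π.flow s z ≠ none by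
    intro s hs
    obtain ⟨w, hw⟩ := Option.ne_none_iff_exists'.1 (hdef s hs)
    exact ⟨w, key s hs w hw, hw⟩
  by_contra! hex
  obtain ⟨s₀, hs₀, hs₀n⟩ := hex
  set S : Set ℝ≥0 := {s | π.flow s z = none} with hS
  have hT : sInf S ≤ s₀ := csInf_le (OrderBot.bddBelow S) hs₀n
  have hdefT : (π.flow (sInf S) z).isSome := by
    refine hadm.2 z _ fun s hs => ?_
    have hsS : s ∉ S := notMem_of_lt_csInf hs (OrderBot.bddBelow S)
    obtain ⟨w, hw⟩ := Option.ne_none_iff_exists'.1 hsS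
    exact ⟨w, key s (hs.le.trans (hT.trans hs₀)) w hw, hw⟩
  have hopen : IsOpen Sᶜ := by
    have : Sᶜ = (fun s => (s, z)) ⁻¹' {p : ℝ≥0 × Z | (π.flow p.1 p.2).isSome = true} := by
      ext s
      simp [hS, Option.isSome_iff_ne_none]
    rw [this]
    exact π.isOpen_dom.preimage (by fun_prop)
  have hmem : π.flow (sInf S) z = none :=
    (isOpen_compl_iff.1 hopen).csInf_mem ⟨s₀, hs₀n⟩ (OrderBot.bddBelow S)
  rw [hmem] at hdefT
  exact absurd hdefT (by simp)

theorem segMem_of_forall_lt {t : ℝ≥0} {z : Z} {M : Set Z} (hM : IsClosed M)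
    (hadm : π.StronglyAdmissible M) (hz : z ∈ M) (h : ∀ s < t, π.mem s z M) :
    π.segMem t z M := by
  intro s hs
  obtain hs | rfl := hs.lt_or_eq
  · exact h s hs
  obtain rfl | h0 := eq_zero_or_pos s
  · exact ⟨z, hz, π.flow_zero z⟩
  obtain ⟨w, hw⟩ := Option.isSome_iff_exists.1 (hadm.2 z s h)
  have : (𝓝[<] s).NeBot := nhdsLT_neBot_of_exists_lt ⟨0, h0⟩
  exact ⟨w, mem_of_tendsto (l := 𝓝[<] s) hM (tendsto_id.mono_left nhdsWithin_le_nhds)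
    tendsto_const_nhds hw (eventually_mem_nhdsWithin.mono fun r hr => h r hr), hw⟩

theorem eventually_segMem {t : ℝ≥0} {z : Z} {V : Set Z} (hV : IsOpen V) (h : π.segMem t z V) :
    ∀ᶠ z' in 𝓝 z, π.segMem t z' V := by
  have := (isCompact_Icc (a := (0 : ℝ≥0)) (b := t)).eventually_forall_of_forall_eventually
    (x₀ := z) (P := fun z' s => π.mem s z' V) fun s hs => by
      have := eventually_mem hV (h s hs.2)
      exact (continuous_swap.tendsto (z, s)).eventually this
  exact this.mono fun z' hz' s hs => hz' s ⟨zero_le, hs⟩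

/-- Pointwise limits along an ultrafilter of backward solutions, each of which is only defined
eventually on bounded intervals, in a compact set are backward solutions. -/
theorem mem_InvMinus_of_tendsto [T2Space Z] {ι : Type*} {l : Ultrafilter ι} {M : Set Z}
    (hM : IsCompact M) (hadm : π.StronglyAdmissible M) {v : ι → ℝ → Z} {z : Z}
    (hv : ∀ T : ℝ, ∀ᶠ i in (l : Filter ι), (∀ t, T ≤ t → t ≤ 0 → v i t ∈ M) ∧
      ∀ (t : ℝ) (s : ℝ≥0), T ≤ t → t + s ≤ 0 → π.flow s (v i t) = some (v i (t + s)))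
    (hz : Tendsto (fun i => v i 0) l (𝓝 z)) : z ∈ π.InvMinus M := by
  have hlim : ∀ t : ℝ, ∃ x, t ≤ 0 → x ∈ M ∧ Tendsto (fun i => v i t) l (𝓝 x) := by
    intro t
    by_cases ht : t ≤ 0
    · obtain ⟨x, hx, hlx⟩ := hM.ultrafilter_le_nhds' (l.map fun i => v i t)
        ((hv t).mono fun i hi => hi.1 t le_rfl ht)
      exact ⟨x, fun _ => ⟨hx, hlx⟩⟩
    · exact ⟨z, fun h => absurd h ht⟩
  choose u hu using hlim
  refine ⟨u, fun t ht => (hu t ht).1, fun t s hts => ?_,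
    tendsto_nhds_unique (hu 0 le_rfl).2 hz⟩
  have ht : t ≤ 0 := by linarith [s.coe_nonneg]
  have hseg : π.segMem s (u t) M := by
    refine segMem_of_tendsto hM.isClosed hadm (hu t ht).2 ?_
    filter_upwards [hv t] with i hi r hr
    have hr' : (r : ℝ) ≤ s := hr
    exact ⟨_, hi.1 _ (by linarith [r.coe_nonneg]) (by linarith), hi.2 t r le_rfl (by linarith)⟩
  obtain ⟨y, -, hy⟩ := hseg s le_rfl
  rw [hy, tendsto_nhds_unique (tendsto_flow tendsto_const_nhds (hu t ht).2 hy
    ((hv t).mono fun i hi => hi.2 t s le_rfl hts)) (hu _ hts).2]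

theorem Inv_subset_InvMinus {M : Set Z} : π.Inv M ⊆ π.InvMinus M := by
  rintro z ⟨u, hu, huM, rfl⟩
  exact ⟨u, fun t _ => huM t, fun t s _ => hu t s, rfl⟩

theorem isClosed_InvMinus [T2Space Z] {M : Set Z} (hM : IsCompact M)
    (hadm : π.StronglyAdmissible M) : IsClosed (π.InvMinus M) := by
  refine isClosed_iff_ultrafilter.2 fun z l hl hlM => ?_
  have : ∀ x : Z, ∃ u : ℝ → Z, x ∈ π.InvMinus M → (∀ t ≤ (0 : ℝ), u t ∈ M) ∧
      (∀ (t₀ : ℝ) (s : ℝ≥0), t₀ + (s : ℝ) ≤ 0 →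
        π.flow s (u t₀) = some (u (t₀ + (s : ℝ)))) ∧ u 0 = x := by
    intro x
    by_cases hx : x ∈ π.InvMinus M
    · obtain ⟨u, hu⟩ := hx
      exact ⟨u, fun _ => hu⟩
    · exact ⟨fun _ => x, fun h => absurd h hx⟩
  choose v hv using this
  refine mem_InvMinus_of_tendsto (l := l) hM hadm (v := v) (fun T => ?_) ?_
  · filter_upwards [hlM] with x hx
    exact ⟨fun t _ ht => (hv x hx).1 t ht, fun t s _ hts => (hv x hx).2.1 t s hts⟩
  · refine Tendsto.congr' ?_ hl
    filter_upwards [hlM] with x hx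
    exact ((hv x hx).2.2).symm

theorem mem_Inv_of_mem_InvMinus {M : Set Z} {z : Z} (hz : z ∈ π.InvMinus M)
    (h : ∀ t, π.segMem t z M) : z ∈ π.Inv M := by
  obtain ⟨u, huM, hu, rfl⟩ := hz
  choose f hfM hf using fun t => h t t le_rfl
  refine ⟨fun t => if t ≤ 0 then u t else f t.toNNReal, fun t s => ?_, fun t => ?_, by simp⟩
  · by_cases ht : t ≤ 0
    · by_cases hts : t + s ≤ 0
      · simp only [ht, hts, if_true]
        exact hu t s hts
      · simp only [ht, hts, if_true, if_false]
        have h1 : π.flow (-t).toNNReal (u t) = some (u 0) := by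
          have := hu t (-t).toNNReal (by rw [Real.coe_toNNReal _ (by linarith)]; linarith)
          rwa [Real.coe_toNNReal _ (by linarith), add_neg_cancel] at this
        have h2 : s = (-t).toNNReal + (t + s).toNNReal := by
          apply NNReal.coe_injective
          push_cast
          rw [Real.coe_toNNReal _ (by linarith), Real.coe_toNNReal _ (by linarith)]
          ring
        conv_lhs => rw [h2]
        rw [flow_add_of_eq_some h1, hf]
    · have hts : ¬ t + s ≤ 0 := by linarith [s.coe_nonneg]
      simp only [ht, hts, if_false]
      rw [← flow_add_of_eq_some (hf _), ← hf, Real.toNNReal_add (by linarith) s.coe_nonneg,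
        Real.toNNReal_coe]
  · dsimp only
    split_ifs with ht
    · exact huM t ht
    · exact hfM _

theorem segMem_Inv {M : Set Z} {z : Z} (hz : z ∈ π.Inv M) (t : ℝ≥0) :
    π.segMem t z (π.Inv M) := by
  obtain ⟨u, hu, huM, rfl⟩ := hz
  refine fun s _ => ⟨u s, ⟨fun t => u (s + t), fun t r => ?_, fun t => huM _, by simp⟩, ?_⟩
  · rw [hu, add_assoc]
  · rw [hu, zero_add]

end Topological

theorem StronglyAdmissible.isCompact {Z : Type*} [MetricSpace Z] {π : PartialSemiflow Z}
    {M : Set Z} (hadm : π.StronglyAdmissible M) (hM : IsClosed M) : IsCompact M := by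
  refine IsSeqCompact.isCompact fun z hz => ?_
  obtain ⟨w, hw, φ, hφ, x, hx⟩ := hadm.1 z (fun _ => 0) fun n s hs => by
    obtain rfl : s = 0 := le_antisymm hs zero_le
    exact ⟨z n, hz n, π.flow_zero _⟩
  obtain rfl : w = z := funext fun n => by simpa [π.flow_zero] using (hw n).symm
  exact ⟨x, hM.mem_of_tendsto hx (Eventually.of_forall fun n => hz _), φ, hφ, hx⟩

end PartialSemiflow

section ExitTime

variable {σ : GlobalSemiflow Y} {π : PartialSemiflow (Y × X)} {y₀ : Y} {N U : Set (Y × X)}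

theorem trans_mem_hullPlus {y : Y} (t : ℝ≥0) (hy : y ∈ hullPlus σ y₀) :
    σ.trans t y ∈ hullPlus σ y₀ := by
  refine map_mem_closure (f := σ.trans t)
    (σ.continuous_trans.comp (by fun_prop : Continuous fun y : Y => (t, y))) hy ?_
  rintro _ ⟨s, rfl⟩
  exact ⟨s + t, σ.trans_add s t y₀⟩

theorem continuous_rMap : Continuous (rMap (X := X) σ y₀) :=
  (σ.continuous_trans.comp (by fun_prop : Continuous fun p : ℝ≥0 × X => (p.1, y₀))).prodMk
    continuous_snd

theorem chiMem_preimage_rMap (hσπ : σ.IsSkewProduct π) {s : ℝ≥0} {p : ℝ≥0 × X}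
    {M : Set (Y × X)} :
    chiMem σ π y₀ s p (rMap σ y₀ ⁻¹' M) ↔ π.mem s (rMap σ y₀ p) M := by
  have key : ∀ w, π.flow s (rMap σ y₀ p) = some w → rMap σ y₀ (p.1 + s, w.2) = w := fun w hw =>
    Prod.ext ((σ.trans_add _ _ _).trans (hσπ _ _ _ _ hw).symm) rfl
  constructor
  · rintro ⟨q, hq, hpq⟩
    obtain ⟨w, hw, rfl⟩ := Option.map_eq_some_iff.1 hpq
    have hq' : rMap σ y₀ (p.1 + s, w.2) ∈ M := hq
    exact ⟨w, key w hw ▸ hq', hw⟩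
  · rintro ⟨w, hwM, hw⟩
    refine ⟨(p.1 + s, w.2), ?_, Option.map_eq_some_iff.2 ⟨w, hw, rfl⟩⟩
    rw [mem_preimage, key w hw]
    exact hwM

theorem flow_mem_extSpace (hσπ : σ.IsSkewProduct π) {t : ℝ≥0} {z w : Y × X}
    (hz : z ∈ extSpace σ y₀) (hw : π.flow t z = some w) : w ∈ extSpace σ y₀ :=
  ⟨hσπ t z.1 z.2 w hw ▸ trans_mem_hullPlus t hz.1, mem_univ _⟩

theorem le_gPlus {t : ℝ≥0} {z : Y × X} (h : π.segMem t z U) : (t : ℝ≥0∞) ≤ gPlus π U z :=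
  le_iSup₂_of_le t h le_rfl

theorem exists_segMem_of_lt_gPlus {c : ℝ≥0∞} {z : Y × X} (h : c < gPlus π U z) :
    ∃ t : ℝ≥0, c < t ∧ π.segMem t z U := by
  obtain ⟨t, ht⟩ := lt_iSup_iff.1 h
  obtain ⟨htU, ht⟩ := lt_iSup_iff.1 ht
  exact ⟨t, ht, htU⟩

theorem segMem_of_lt_gPlus {t : ℝ≥0} {z : Y × X} (h : (t : ℝ≥0∞) < gPlus π U z) :
    π.segMem t z U := by
  obtain ⟨s, hts, hs⟩ := exists_segMem_of_lt_gPlus h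
  exact hs.mono (by exact_mod_cast hts.le)

theorem segMem_of_le_gPlus (hN : IsClosed N) (hadm : π.StronglyAdmissible N) (hUN : U ⊆ N)
    {t : ℝ≥0} {z : Y × X} (hz : z ∈ N) (h : (t : ℝ≥0∞) ≤ gPlus π U z) : π.segMem t z N := by
  refine PartialSemiflow.segMem_of_forall_lt hN hadm hz fun s hs => ?_
  obtain ⟨w, hw, hw'⟩ := segMem_of_lt_gPlus ((ENNReal.coe_lt_coe.2 hs).trans_le h) s le_rfl
  exact ⟨w, hUN hw, hw'⟩

theorem gPlus_le_add {t : ℝ≥0} {z w : Y × X} (hw : π.flow t z = some w) :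
    gPlus π U z ≤ t + gPlus π U w := by
  refine iSup₂_le fun s hs => ?_
  obtain hst | hts := le_total s t
  · exact (ENNReal.coe_le_coe.2 hst).trans le_self_add
  · have hseg : π.segMem (s - t) w U := fun r hr => by
      have : t + r ≤ s := by
        calc t + r ≤ t + (s - t) := by gcongr
          _ = s := add_tsub_cancel_of_le hts
      obtain ⟨v, hv, hv'⟩ := hs (t + r) this
      exact ⟨v, hv, by rwa [PartialSemiflow.flow_add_of_eq_some hw] at hv'⟩
    calc (s : ℝ≥0∞) = t + (s - t : ℝ≥0) := by
          rw [← ENNReal.coe_add, add_tsub_cancel_of_le hts]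
      _ ≤ t + gPlus π U w := by gcongr; exact le_gPlus hseg

theorem add_gPlus_le {t : ℝ≥0} {z w : Y × X} (hw : π.flow t z = some w)
    (ht : (t : ℝ≥0∞) ≤ gPlus π U z) : t + gPlus π U w ≤ gPlus π U z := by
  suffices gPlus π U w ≤ gPlus π U z - t by
    calc t + gPlus π U w ≤ t + (gPlus π U z - t) := by gcongr
      _ = gPlus π U z := add_tsub_cancel_of_le ht
  refine iSup₂_le fun s hs => ENNReal.le_sub_of_add_le_left ENNReal.coe_ne_top ?_
  rw [← ENNReal.coe_add]
  refine le_gPlus fun r hr => ?_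
  obtain hrt | htr := lt_or_ge r t
  · exact segMem_of_lt_gPlus ((ENNReal.coe_lt_coe.2 hrt).trans_le ht) r le_rfl
  · obtain ⟨v, hv, hv'⟩ := hs (r - t) (tsub_le_iff_left.2 hr)
    refine ⟨v, hv, ?_⟩
    rw [← hv', ← PartialSemiflow.flow_add_of_eq_some hw, add_tsub_cancel_of_le htr]

theorem gPlus_eq_add {t : ℝ≥0} {z w : Y × X} (hw : π.flow t z = some w)
    (ht : (t : ℝ≥0∞) ≤ gPlus π U z) : gPlus π U z = t + gPlus π U w :=
  (gPlus_le_add hw).antisymm (add_gPlus_le hw ht)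

theorem gMinus_le_iff {z : Y × X} {c : ℝ≥0∞} :
    gMinus π U N z ≤ c ↔ ∀ (t : ℝ≥0) (w : Y × X), (t : ℝ≥0∞) ≤ gPlus π U z →
      π.flow t z = some w → Metric.infEDist w (π.InvMinus N) ≤ c := by
  simp only [gMinus, iSup_le_iff]
  exact ⟨fun h t w ht hw => h t ht w hw, fun h t ht w hw => h t w ht hw⟩

theorem gMinus_flow_le {t : ℝ≥0} {z w : Y × X} (hw : π.flow t z = some w)
    (ht : (t : ℝ≥0∞) ≤ gPlus π U z) : gMinus π U N w ≤ gMinus π U N z := by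
  refine gMinus_le_iff.2 fun s v hs hv => gMinus_le_iff.1 le_rfl (t + s) v ?_ ?_
  · rw [gPlus_eq_add hw ht, ENNReal.coe_add]
    gcongr
  · rw [PartialSemiflow.flow_add_of_eq_some hw, hv]

theorem eventually_lt_gPlus (hσπ : σ.IsSkewProduct π)
    (hU : ∃ V : Set (Y × X), IsOpen V ∧ U = V ∩ extSpace σ y₀) {c : ℝ≥0∞} {z : Y × X}
    (h : c < gPlus π U z) : ∀ᶠ z' in 𝓝[extSpace σ y₀] z, c < gPlus π U z' := by
  obtain ⟨V, hV, rfl⟩ := hU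
  obtain ⟨t, hct, ht⟩ := exists_segMem_of_lt_gPlus h
  have htV : π.segMem t z V := fun s hs => by
    obtain ⟨w, hw, hw'⟩ := ht s hs
    exact ⟨w, hw.1, hw'⟩
  filter_upwards [nhdsWithin_le_nhds (PartialSemiflow.eventually_segMem hV htV),
    self_mem_nhdsWithin] with z' hz' hz'E
  refine hct.trans_le (le_gPlus fun s hs => ?_)
  obtain ⟨w, hw, hw'⟩ := hz' s hs
  exact ⟨w, ⟨hw, flow_mem_extSpace hσπ hz'E hw'⟩, hw'⟩

theorem isClosed_gPlus_le (hσπ : σ.IsSkewProduct π)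
    (hU : ∃ V : Set (Y × X), IsOpen V ∧ U = V ∩ extSpace σ y₀) (hN : IsClosed N)
    (hNE : N ⊆ extSpace σ y₀) (c : ℝ≥0∞) : IsClosed {z ∈ N | gPlus π U z ≤ c} := by
  refine isClosed_of_closure_subset fun z hz => ⟨?_, ?_⟩
  · exact hN.closure_subset_iff.2 (fun _ h => h.1) hz
  · by_contra! hc
    have := mem_closure_iff_nhdsWithin_neBot.1 hz
    have hle : 𝓝[{z ∈ N | gPlus π U z ≤ c}] z ≤ 𝓝[extSpace σ y₀] z :=
      nhdsWithin_mono z fun x hx => hNE hx.1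
    obtain ⟨z', hz', hz'N⟩ := (((eventually_lt_gPlus hσπ hU hc).filter_mono hle).and
      self_mem_nhdsWithin).exists
    exact hz'.not_ge hz'N.2

theorem isClosed_gMinus_le (hσπ : σ.IsSkewProduct π)
    (hU : ∃ V : Set (Y × X), IsOpen V ∧ U = V ∩ extSpace σ y₀) (hN : IsClosed N)
    (hNE : N ⊆ extSpace σ y₀) (hadm : π.StronglyAdmissible N) (hUN : U ⊆ N) (c : ℝ≥0∞) :
    IsClosed {z ∈ N | gMinus π U N z ≤ c} := by
  refine isClosed_of_closure_subset fun z hz => ?_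
  have hzN : z ∈ N := hN.closure_subset_iff.2 (fun _ h => h.1) hz
  have hne := mem_closure_iff_nhdsWithin_neBot.1 hz
  set l := 𝓝[{z ∈ N | gMinus π U N z ≤ c}] z with hl
  have hlz : Tendsto id l (𝓝 z) := tendsto_id.mono_left nhdsWithin_le_nhds
  have hlS : ∀ᶠ z' in l, z' ∈ N ∧ gMinus π U N z' ≤ c := self_mem_nhdsWithin
  have hlE : l ≤ 𝓝[extSpace σ y₀] z := nhdsWithin_mono z fun x hx => hNE hx.1
  let C : Set (Y × X) := {w | Metric.infEDist w (π.InvMinus N) ≤ c}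
  have hclosed : IsClosed C :=
    isClosed_le Metric.continuous_infEDist continuous_const
  have key : ∀ (t : ℝ≥0) (w : Y × X), (∀ᶠ z' in l, (t : ℝ≥0∞) ≤ gPlus π U z') →
      π.flow t z = some w → Metric.infEDist w (π.InvMinus N) ≤ c := fun t w ht hw => by
    refine PartialSemiflow.mem_of_tendsto (l := l) (M := C) hclosed tendsto_const_nhds hlz hw ?_
    filter_upwards [ht, hlS] with z' ht hz'
    obtain ⟨v, -, hv⟩ := segMem_of_le_gPlus hN hadm hUN hz'.1 ht t le_rfl
    exact ⟨v, gMinus_le_iff.1 hz'.2 t v ht hv, hv⟩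
  have hlt : ∀ t : ℝ≥0, (t : ℝ≥0∞) < gPlus π U z → ∀ᶠ z' in l, (t : ℝ≥0∞) ≤ gPlus π U z' :=
    fun t ht => hlE ((eventually_lt_gPlus hσπ hU ht).mono fun _ h => h.le)
  refine ⟨hzN, gMinus_le_iff.2 fun t w ht hw => ?_⟩
  obtain rfl | h0 := eq_zero_or_pos t
  · exact key 0 w (Eventually.of_forall fun _ => by simp) hw
  · have : (𝓝[<] t).NeBot := nhdsLT_neBot_of_exists_lt ⟨0, h0⟩
    refine PartialSemiflow.mem_of_tendsto (l := 𝓝[<] t) (τ := id) (M := C) hclosed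
      (tendsto_id.mono_left nhdsWithin_le_nhds) (tendsto_const_nhds (x := z)) hw ?_
    filter_upwards [self_mem_nhdsWithin] with s hs
    have hs' : (s : ℝ≥0∞) < gPlus π U z := (ENNReal.coe_lt_coe.2 hs).trans_le ht
    obtain ⟨v, -, hv⟩ := segMem_of_lt_gPlus hs' s le_rfl
    exact ⟨v, key s v (hlt s hs') hv, hv⟩

theorem gPlus_eq_top_of_mem_Inv (hU : π.Inv N ⊆ U) {z : Y × X} (hz : z ∈ π.Inv N) :
    gPlus π U z = ⊤ := by
  refine ENNReal.eq_top_of_forall_nnreal_le fun t => le_gPlus fun s hs => ?_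
  obtain ⟨w, hw, hw'⟩ := PartialSemiflow.segMem_Inv hz t s hs
  exact ⟨w, hU hw, hw'⟩

/-- Orbits starting near `Inv N` remain close to `InvMinus N` while they stay in `U`. -/
theorem eventually_gMinus_le (hσπ : σ.IsSkewProduct π)
    (hU : ∃ V : Set (Y × X), IsOpen V ∧ U = V ∩ extSpace σ y₀) (hN : IsClosed N)
    (hadm : π.StronglyAdmissible N) (hUN : U ⊆ N) (hKU : π.Inv N ⊆ U) {c : ℝ≥0∞} (hc : 0 < c)
    {z : Y × X} (hz : z ∈ π.Inv N) :
    ∀ᶠ z' in 𝓝[extSpace σ y₀] z, gMinus π U N z' ≤ c := by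
  have hgt : ∀ T : ℝ≥0, ∀ᶠ z' in 𝓝[extSpace σ y₀] z, (T : ℝ≥0∞) < gPlus π U z' := fun T =>
    eventually_lt_gPlus hσπ hU (by simp [gPlus_eq_top_of_mem_Inv hKU hz])
  by_contra hcon
  rw [not_eventually, frequently_iff_neBot] at hcon
  set l := Ultrafilter.of (𝓝[extSpace σ y₀] z ⊓ 𝓟 {z' | ¬ gMinus π U N z' ≤ c})
  have hlE : (l : Filter (Y × X)) ≤ 𝓝[extSpace σ y₀] z := (Ultrafilter.of_le _).trans inf_le_left
  have hlz : Tendsto id (l : Filter (Y × X)) (𝓝 z) :=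
    tendsto_id.mono_left (hlE.trans nhdsWithin_le_nhds)
  have hlc : ∀ᶠ z' in (l : Filter (Y × X)), ¬ gMinus π U N z' ≤ c :=
    (Ultrafilter.of_le _).trans inf_le_right (mem_principal_self _)
  have hlN : ∀ᶠ z' in (l : Filter (Y × X)), z' ∈ N := by
    filter_upwards [hlE (hgt 0)] with z' hz'
    obtain ⟨w, hw, hw'⟩ := segMem_of_lt_gPlus hz' 0 le_rfl
    obtain rfl : z' = w := Option.some.inj ((π.flow_zero z').symm.trans hw')
    exact hUN hw
  have : ∀ z' : Y × X, ∃ (t : ℝ≥0) (w : Y × X), ¬ gMinus π U N z' ≤ c →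
      (t : ℝ≥0∞) ≤ gPlus π U z' ∧ π.flow t z' = some w ∧
        c < Metric.infEDist w (π.InvMinus N) := fun z' => by
    by_cases h : gMinus π U N z' ≤ c
    · exact ⟨0, z', fun h' => absurd h h'⟩
    · have h' := h
      rw [gMinus_le_iff] at h'
      push Not at h'
      obtain ⟨t, w, h₁, h₂, h₃⟩ := h'
      exact ⟨t, w, fun _ => ⟨h₁, h₂, h₃⟩⟩
  choose t w htw using this
  have hwflow : ∀ᶠ z' in (l : Filter (Y × X)), π.flow (t z') z' = some (w z') :=
    hlc.mono fun z' h => (htw z' h).2.1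
  have hseg : ∀ᶠ z' in (l : Filter (Y × X)), π.segMem (t z') z' N := by
    filter_upwards [hlc, hlN] with z' h₁ h₂
    exact segMem_of_le_gPlus hN hadm hUN h₂ (htw z' h₁).1
  suffices ∃ x ∈ π.InvMinus N, Tendsto w l (𝓝 x) by
    obtain ⟨x, hx, hwx⟩ := this
    have h₁ : c ≤ Metric.infEDist x (π.InvMinus N) :=
      ge_of_tendsto ((Metric.continuous_infEDist.tendsto x).comp hwx)
        (hlc.mono fun z' h => (htw z' h).2.2.le)
    rw [Metric.infEDist_zero_of_mem hx] at h₁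
    exact hc.not_ge h₁
  by_cases hbdd : ∃ T : ℝ≥0, ∀ᶠ z' in (l : Filter (Y × X)), t z' ≤ T
  · obtain ⟨T, hT⟩ := hbdd
    obtain ⟨t₀, -, ht₀⟩ := (isCompact_Icc (a := (0 : ℝ≥0)) (b := T)).ultrafilter_le_nhds'
      (l.map t) (hT.mono fun z' h => ⟨zero_le, h⟩)
    obtain ⟨x, hx, hx'⟩ := PartialSemiflow.segMem_Inv hz t₀ t₀ le_rfl
    exact ⟨x, PartialSemiflow.Inv_subset_InvMinus hx,
      PartialSemiflow.tendsto_flow ht₀ hlz hx' hwflow⟩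
  · have hlarge : ∀ T : ℝ≥0, ∀ᶠ z' in (l : Filter (Y × X)), T ≤ t z' := fun T =>
      (Ultrafilter.eventually_not.2 fun h => hbdd ⟨T, h⟩).mono fun z' h => (not_le.1 h).le
    have hcomp := hadm.isCompact hN
    have hwN : ∀ᶠ z' in (l : Filter (Y × X)), w z' ∈ N := by
      filter_upwards [hseg, hwflow] with z' h₁ h₂
      obtain ⟨v, hv, hv'⟩ := h₁ _ le_rfl
      exact Option.some.inj (hv'.symm.trans h₂) ▸ hv
    obtain ⟨x, hx, hwx⟩ := hcomp.ultrafilter_le_nhds' (l.map w) hwN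
    refine ⟨x, ?_, hwx⟩
    refine PartialSemiflow.mem_InvMinus_of_tendsto (l := l) hcomp hadm
      (v := fun z' τ => (π.flow (t z' + τ).toNNReal z').getD z') (fun T => ?_) ?_
    · filter_upwards [hseg, hlarge (-T).toNNReal] with z' h₁ h₂
      have h₂' : -T ≤ t z' := Real.toNNReal_le_iff_le_coe.1 h₂
      have hflow : ∀ τ : ℝ, T ≤ τ → τ ≤ 0 → ∃ v ∈ N, π.flow (t z' + τ).toNNReal z' = some v :=
        fun τ _ hτ => h₁ _ (by rw [Real.toNNReal_le_iff_le_coe]; linarith)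
      refine ⟨fun τ hτ₁ hτ₂ => ?_, fun τ s hτ hτs => ?_⟩
      · obtain ⟨v, hv, hv'⟩ := hflow τ hτ₁ hτ₂
        rwa [hv', Option.getD_some]
      · obtain ⟨v, hv, hv'⟩ := hflow τ hτ (by linarith [s.coe_nonneg])
        obtain ⟨v₂, hv₂, hv₂'⟩ := hflow (τ + s) (by linarith [s.coe_nonneg]) hτs
        rw [hv', hv₂', Option.getD_some, Option.getD_some, ← hv₂',
          ← PartialSemiflow.flow_add_of_eq_some hv', ← add_assoc,
          Real.toNNReal_add (by linarith) s.coe_nonneg, Real.toNNReal_coe]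
    · refine Tendsto.congr' ?_ (show Tendsto w l (𝓝 x) from hwx)
      filter_upwards [hwflow] with z' h
      simp [h]

end ExitTime

theorem statement_9 (σ : GlobalSemiflow Y) (π : PartialSemiflow (Y × X)) (hσπ : σ.IsSkewProduct π) (y₀ : Y)
    (K N U : Set (Y × X))
    (hNiso : IsIsolatingNbhd σ π y₀ K N) (hNadm : π.StronglyAdmissible N)
    (hUopen : ∃ V : Set (Y × X), IsOpen V ∧ U = V ∩ extSpace σ y₀)
    (hKU : K ⊆ U) (hUN : U ⊆ N) :
    ∃ c₁bar : ℝ≥0, 0 < c₁bar ∧ ∃ c₂bar : ℝ≥0,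
      ∀ c₁ : ℝ≥0, 0 < c₁ → c₁ ≤ c₁bar → ∀ c₂ : ℝ≥0, c₂bar ≤ c₂ →
        ({z ∈ N | gMinus π U N z ≤ (c₁ : ℝ≥0∞)} ∩
          closure {z ∈ N | (c₂ : ℝ≥0∞) ≤ gPlus π U z}) ⊆ U ∧
        IsIndexPair σ π y₀ K
          (rMap σ y₀ ⁻¹' ({z ∈ N | gMinus π U N z ≤ (c₁ : ℝ≥0∞)} ∩
          closure {z ∈ N | (c₂ : ℝ≥0∞) ≤ gPlus π U z}))
          (rMap σ y₀ ⁻¹' (({z ∈ N | gMinus π U N z ≤ (c₁ : ℝ≥0∞)} ∩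
          closure {z ∈ N | (c₂ : ℝ≥0∞) ≤ gPlus π U z}) ∩
            {z ∈ N | gPlus π U z ≤ (c₂ : ℝ≥0∞)})) := by
  obtain ⟨hNE, hN, -, rfl⟩ := id hNiso
  have hNcomp : IsCompact N := hNadm.isCompact hN
  have hUnear : ∀ z ∈ U, U ∈ 𝓝[extSpace σ y₀] z := by
    obtain ⟨V, hV, rfl⟩ := hUopen
    exact fun z hz => inter_comm V _ ▸ inter_mem_nhdsWithin _ (hV.mem_nhds hz.1)
  set L : ℝ≥0∞ → ℝ≥0∞ → Set (Y × X) := fun a b =>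
    {z ∈ N | gMinus π U N z ≤ a} ∩ closure {z ∈ N | b ≤ gPlus π U z} with hL
  have hLclosed : ∀ a b, IsClosed (L a b) := fun a b =>
    (isClosed_gMinus_le hσπ hUopen hN hNE hNadm hUN a).inter isClosed_closure
  have hLmono : ∀ {a a' b b'}, a ≤ a' → b' ≤ b → L a b ⊆ L a' b' := fun ha hb =>
    inter_subset_inter (fun z hz => ⟨hz.1, hz.2.trans ha⟩)
      (closure_mono fun z hz => ⟨hz.1, hb.trans hz.2⟩)
  have hLN : ∀ {a b} {z}, z ∈ L a b → z ∈ N := fun hz => hz.1.1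
  obtain ⟨n, hn⟩ : ∃ n : ℕ, L ((n : ℝ≥0∞) + 1)⁻¹ n ⊆ U := by
    obtain ⟨V, hV, hUV⟩ := id hUopen
    suffices ∃ n : ℕ, L ((n : ℝ≥0∞) + 1)⁻¹ n ⊆ V from
      this.imp fun n hn z hz => hUV ▸ ⟨hn hz, hNE (hLN hz)⟩
    have hanti : Antitone fun n : ℕ => L ((n : ℝ≥0∞) + 1)⁻¹ n := fun m n hmn =>
      hLmono (by gcongr) (by gcongr)
    refine exists_subset_nhds_of_isCompact (directed_of_isDirected_le hanti)
      (fun n => hNcomp.of_isClosed_subset (hLclosed _ _) fun _ => hLN) fun z hz => ?_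
    rw [mem_iInter] at hz
    refine hV.mem_nhds ?_
    have hzU : z ∈ U := by
      refine hKU (PartialSemiflow.mem_Inv_of_mem_InvMinus ?_ fun t => ?_)
      · rw [Metric.mem_iff_infEDist_zero_of_closed
          (PartialSemiflow.isClosed_InvMinus hNcomp hNadm)]
        refine le_antisymm (ENNReal.le_of_forall_pos_le_add fun ε hε _ => ?_) zero_le
        obtain ⟨k, hk⟩ := ENNReal.exists_inv_nat_lt (ENNReal.coe_pos.2 hε).ne'
        rw [zero_add]
        refine (gMinus_le_iff.1 (hz k).1.2 0 z (by simp) (π.flow_zero z)).trans (le_trans ?_ hk.le)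
        gcongr
        exact le_self_add
      · obtain ⟨k, hk⟩ := exists_nat_ge t
        have := mem_closure_iff_nhdsWithin_neBot.1 (hz k).2
        refine PartialSemiflow.segMem_of_tendsto
          (l := 𝓝[{z ∈ N | (k : ℝ≥0∞) ≤ gPlus π U z}] z) (ζ := id) hN hNadm
          (tendsto_id.mono_left nhdsWithin_le_nhds) ?_
        filter_upwards [self_mem_nhdsWithin] with z' hz'
        exact segMem_of_le_gPlus hN hNadm hUN hz'.1
          (le_trans (by exact_mod_cast hk) hz'.2)
    exact (hUV ▸ hzU : z ∈ V ∩ extSpace σ y₀).1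
  refine ⟨((n : ℝ≥0) + 1)⁻¹, by positivity, n, fun c₁ hc₁ hc₁n c₂ hc₂ => ?_⟩
  have hLU : L c₁ c₂ ⊆ U := by
    refine (hLmono ?_ (by exact_mod_cast hc₂)).trans hn
    refine (ENNReal.coe_le_coe.2 hc₁n).trans_eq ?_
    rw [ENNReal.coe_inv (by positivity)]
    push_cast
    rfl
  refine ⟨hLU, ⟨⟨fun p hp => hp.1, (hLclosed _ _).preimage continuous_rMap,
    ((hLclosed _ _).inter (isClosed_gPlus_le hσπ hUopen hN hNE _)).preimage continuous_rMap,
    fun p hp t ht => ?_, fun p hp t ht => ?_⟩, ⟨N, hNiso, hNadm, fun p hp => hLN hp.1⟩, ?_⟩⟩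
  · rw [chiMem_preimage_rMap hσπ] at ht
    simp only [chiMem_preimage_rMap hσπ]
    set z := rMap σ y₀ p
    have hz : z ∈ L c₁ c₂ := hp
    have hstay : ∀ s : ℝ≥0, (s : ℝ≥0∞) + c₂ ≤ gPlus π U z → ∃ w, π.flow s z = some w ∧
        w ∈ L c₁ c₂ ∧ gPlus π U z = s + gPlus π U w := fun s hs => by
      have hs' : (s : ℝ≥0∞) ≤ gPlus π U z := le_self_add.trans hs
      obtain ⟨w, hwN, hw⟩ := segMem_of_le_gPlus hN hNadm hUN (hLN hz) hs' s le_rfl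
      have heq := gPlus_eq_add hw hs'
      refine ⟨w, hw, ⟨⟨hwN, (gMinus_flow_le hw hs').trans hz.1.2⟩, subset_closure ⟨hwN, ?_⟩⟩, heq⟩
      rw [heq] at hs
      exact (ENNReal.add_le_add_iff_left ENNReal.coe_ne_top).1 hs
    obtain hle | hgt := le_or_gt (gPlus π U z) c₂
    · exact ⟨0, zero_le, z, ⟨hz, hLN hz, hle⟩, π.flow_zero z⟩
    have hlt : gPlus π U z < t + c₂ := by
      by_contra! h
      obtain ⟨w, hw, hwL, -⟩ := hstay t h
      exact ht ⟨w, hwL, hw⟩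
    obtain ⟨g, hg⟩ := WithTop.ne_top_iff_exists.1 hlt.ne_top
    change (g : ℝ≥0∞) = _ at hg
    rw [← hg] at hgt hlt
    have hcg : c₂ ≤ g := by exact_mod_cast hgt.le
    have hsum : ((g - c₂ : ℝ≥0) : ℝ≥0∞) + c₂ = gPlus π U z := by
      rw [← ENNReal.coe_add, tsub_add_cancel_of_le hcg, hg]
    obtain ⟨w, hw, hwL, heq⟩ := hstay (g - c₂) hsum.le
    refine ⟨g - c₂, tsub_le_iff_right.2 (by exact_mod_cast hlt.le), w, ⟨hwL, hLN hwL, ?_⟩, hw⟩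
    rw [← hsum] at heq
    exact ((ENNReal.add_right_inj ENNReal.coe_ne_top).1 heq).ge
  · rw [chiMem_preimage_rMap hσπ] at ht
    simp only [chiMem_preimage_rMap hσπ]
    set z := rMap σ y₀ p
    by_contra! hstay
    obtain ⟨w, hwL, hw⟩ := hstay t le_rfl
    have htU : π.segMem t z U := fun s hs => by
      obtain ⟨v, hv, hv'⟩ := hstay s hs
      exact ⟨v, hLU hv, hv'⟩
    have hz : gPlus π U z ≤ c₂ := hp.2.2
    refine ht ⟨w, ⟨hwL, hLN hwL, le_trans ?_ hz⟩, hw⟩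
    rw [gPlus_eq_add hw (le_gPlus htU)]
    exact le_add_self
  · refine ⟨{z ∈ N | gMinus π U N z ≤ c₁ ∧ (c₂ : ℝ≥0∞) < gPlus π U z},
      ⟨fun z hz => hNE hz.1, fun z hz => ?_⟩, fun p hp => ?_⟩
    · filter_upwards [mem_of_superset (hUnear z (hKU hz)) hUN,
        eventually_gMinus_le hσπ hUopen hN hNadm hUN hKU (ENNReal.coe_pos.2 hc₁) hz,
        eventually_lt_gPlus hσπ hUopen (c := c₂)
          (by simp [gPlus_eq_top_of_mem_Inv hKU hz])] with z' h₁ h₂ h₃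
      exact ⟨h₁, h₂, h₃⟩
    · exact ⟨⟨⟨hp.1, hp.2.1⟩, subset_closure ⟨hp.1, hp.2.2.le⟩⟩,
        fun h => (h.2.2 : gPlus π U (rMap σ y₀ p) ≤ c₂).not_gt hp.2.2⟩

end
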